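/- Let G, H be graphs and P : E_G × E_H → ℤ a payoff function. For every m, n ∈ ℕ and all u, w ∈ V_H, the following identity holds: M†_{n+m}(u→w) = ( ⋃_{v ∈ V_H} M†_n(u→v) * M†_m(v→w) )†. -/

import Mathlib

open Filter Set

structure DirGraph (V E : Type) where
  src : E → V
  tgt : E → V

namespace DirGraph

variable {V E : Type}

/-- A (finite) walk: consecutive edges are compatible. -/
def IsWalkList (G : DirGraph V E) (p : List E) : Prop :=
  p.Chain' fun e f => G.tgt e = G.src f

/-- The set of walks of length `n`. -/
def walks (G : DirGraph V E) (n : ℕ) : Set (List E) :=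
  {p | p.length = n ∧ G.IsWalkList p}

/-- The set of walks of length `n` from `v` to `w`. -/
def walksFT (G : DirGraph V E) (n : ℕ) (v w : V) : Set (List E) :=
  {p | p.length = n ∧ G.IsWalkList p ∧
    ∃ h : p ≠ [], G.src (p.head h) = v ∧ G.tgt (p.getLast h) = w}

def IsCycle (G : DirGraph V E) (p : List E) : Prop :=
  G.IsWalkList p ∧ ∃ h : p ≠ [], G.src (p.head h) = G.tgt (p.getLast h)

def Irreducible (G : DirGraph V E) : Prop :=
  ∀ v w : V, ∃ n : ℕ, (G.walksFT n v w).Nonempty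

/-- Irreducible and the gcd of all cycle lengths is 1 (every common divisor of
the cycle lengths equals 1). -/
def Primitive (G : DirGraph V E) : Prop :=
  G.Irreducible ∧ ∀ d : ℕ, (∀ p, G.IsCycle p → d ∣ p.length) → d = 1

end DirGraph

/-- `Σ_i P(q_i, p_i)`. -/
def payoffSum {EG EH : Type} (P : EG → EH → ℤ) (q : List EG) (p : List EH) : ℤ :=
  (List.zipWith P q p).sum

/-- `V_n(G,H,P) = max_{p ∈ W_n(H)} min_{q ∈ W_n(G)} Σ P(q_i,p_i)`. -/
noncomputable def Vn {VG EG VH EH : Type} (G : DirGraph VG EG) (H : DirGraph VH EH)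
    (P : EG → EH → ℤ) (n : ℕ) : ℤ :=
  sSup ((fun p => sInf ((fun q => payoffSum P q p) '' G.walks n)) '' H.walks n)

/-- `M(p)(v,w) = inf {Σ P(q_i,p_i) : q ∈ W_n(G, v → w)}`, with `inf ∅ = ⊤`. -/
noncomputable def Mfun {VG EG EH : Type} (G : DirGraph VG EG) (P : EG → EH → ℤ)
    (p : List EH) : VG → VG → WithTop ℤ :=
  fun v w => sInf ((fun q => ((payoffSum P q p : ℤ) : WithTop ℤ)) '' G.walksFT p.length v w)

/-- `f < g` pointwise everywhere. -/
def StrictDom {V α : Type} [LT α] (f g : V → V → α) : Prop := ∀ v w, f v w < g v w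

/-- `<`-maximal elements of a set w.r.t. a strict domination relation. -/
def maxElems {α : Type} (lt : α → α → Prop) (A : Set α) : Set α :=
  {f ∈ A | ¬ ∃ g ∈ A, lt f g}

/-- Tropical convolution on `(ℤ ∪ {∞})`-valued matrices. -/
noncomputable def tconv {V : Type} (f g : V → V → WithTop ℤ) : V → V → WithTop ℤ :=
  fun u w => sInf (Set.range fun v => f u v + g v w)

/-- Tropical convolution on `ℤ`-valued matrices. -/
noncomputable def tconvZ {V : Type} (f g : V → V → ℤ) : V → V → ℤ :=
  fun u w => sInf (Set.range fun v => f u v + g v w)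

/-- Non-improvable walks in `H` (of any length). -/
noncomputable def walksDagger {VG EG VH EH : Type} (G : DirGraph VG EG) (H : DirGraph VH EH)
    (P : EG → EH → ℤ) : Set (List EH) :=
  {p | ∃ u v : VH, p ∈ H.walksFT p.length u v ∧
    Mfun G P p ∈ maxElems StrictDom (Mfun G P '' H.walksFT p.length u v)}

/-- The edge shift of a graph. -/
def XEdge {V E : Type} (G : DirGraph V E) : Set (ℤ → E) :=
  {x | ∀ n : ℤ, G.tgt (x n) = G.src (x (n + 1))}

/-- The word `x_{[m,n]}` as a list (of length `n - m + 1` when `m ≤ n`). -/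
def seg {A : Type} (x : ℤ → A) (m n : ℤ) : List A :=
  List.ofFn fun i : Fin (n + 1 - m).toNat => x (m + i)

/-- `X_H^†`: points all of whose subwords are non-improvable walks. -/
noncomputable def XHdag {VG EG VH EH : Type} (G : DirGraph VG EG) (H : DirGraph VH EH)
    (P : EG → EH → ℤ) : Set (ℤ → EH) :=
  {x | x ∈ XEdge H ∧ ∀ m n : ℤ, m ≤ n → seg x m n ∈ walksDagger G H P}

/-- `R(p)`: optimal responses to `p`. -/
noncomputable def Rset {VG EG EH : Type} (G : DirGraph VG EG) (P : EG → EH → ℤ)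
    (p : List EH) : Set (List EG) :=
  {q | ∃ v w : VG, q ∈ G.walksFT p.length v w ∧
    ((payoffSum P q p : ℤ) : WithTop ℤ) = Mfun G P p v w}

theorem WithTop.le_sInf_iff_of_finite {S : Set (WithTop ℤ)} (hS : S.Finite) (a : WithTop ℤ) :
    a ≤ sInf S ↔ ∀ b ∈ S, a ≤ b := by
  rcases S.eq_empty_or_nonempty with rfl | hne
  · simp [WithTop.sInf_empty]
  · exact le_csInf_iff hS.bddBelow hne

namespace DirGraph

variable {V E : Type}

theorem append_mem_walksFT (G : DirGraph V E) {n m : ℕ} {u v w : V} {p q : List E}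
    (hp : p ∈ G.walksFT n u v) (hq : q ∈ G.walksFT m v w) :
    p ++ q ∈ G.walksFT (n + m) u w := by
  obtain ⟨hpl, hpc, hp0, hps, hpt⟩ := hp
  obtain ⟨hql, hqc, hq0, hqs, hqt⟩ := hq
  refine ⟨by simp [hpl, hql], ?_, by simp [hp0], ?_, ?_⟩
  · refine List.isChain_append.2 ⟨hpc, hqc, fun x hx y hy => ?_⟩
    rw [List.getLast?_eq_some_getLast hp0, Option.mem_some_iff] at hx
    rw [List.head?_eq_some_head hq0, Option.mem_some_iff] at hy
    rw [← hx, ← hy, hpt, hqs]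
  · rwa [List.head_append_of_ne_nil hp0]
  · rwa [List.getLast_append_of_ne_nil _ hq0]

theorem exists_append_of_mem_walksFT (G : DirGraph V E) {n m : ℕ} (hn : 0 < n) (hm : 0 < m)
    {u w : V} {r : List E} (hr : r ∈ G.walksFT (n + m) u w) :
    ∃ v, ∃ p ∈ G.walksFT n u v, ∃ q ∈ G.walksFT m v w, p ++ q = r := by
  obtain ⟨hl, hc, h0, hs, ht⟩ := hr
  have hp0 : r.take n ≠ [] := by
    rw [← List.length_pos_iff, List.length_take]; omega
  have hq0 : r.drop n ≠ [] := by
    rw [← List.length_pos_iff, List.length_drop]; omega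
  have hc' := hc
  unfold IsWalkList at hc'
  rw [← List.take_append_drop n r] at hc'
  obtain ⟨hpc, hqc, hpq⟩ := List.isChain_append.1 hc'
  refine ⟨G.tgt ((r.take n).getLast hp0), r.take n, ⟨by simp [hl], hpc, hp0, ?_, rfl⟩,
    r.drop n, ⟨by simp [hl], hqc, hq0, ?_, ?_⟩, List.take_append_drop n r⟩
  · rw [List.head_take]; exact hs
  · exact (hpq _ (List.getLast?_eq_some_getLast hp0) _ (List.head?_eq_some_head hq0)).symm
  · rwa [List.getLast_drop]

theorem finite_walksFT [Finite E] (G : DirGraph V E) (n : ℕ) (v w : V) :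
    (G.walksFT n v w).Finite :=
  (List.finite_length_eq E n).subset fun _ hp => hp.1

theorem singleton_mem_walksFT (G : DirGraph V E) (e : E) :
    [e] ∈ G.walksFT 1 (G.src e) (G.tgt e) :=
  ⟨rfl, List.isChain_singleton e, by simp, rfl, rfl⟩

theorem exists_walksFT_to (G : DirGraph V E) (h : ∀ v, ∃ e, G.tgt e = v) {m : ℕ} (hm : 0 < m)
    (w : V) : ∃ v, (G.walksFT m v w).Nonempty := by
  induction m, hm using Nat.le_induction with
  | base =>
    obtain ⟨e, rfl⟩ := h w
    exact ⟨_, _, G.singleton_mem_walksFT e⟩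
  | succ m _ ih =>
    obtain ⟨v, p, hp⟩ := ih
    obtain ⟨e, rfl⟩ := h v
    exact ⟨_, _, Nat.add_comm 1 m ▸ G.append_mem_walksFT (G.singleton_mem_walksFT e) hp⟩

theorem exists_walksFT_from (G : DirGraph V E) (h : ∀ v, ∃ e, G.src e = v) {m : ℕ} (hm : 0 < m)
    (v : V) : ∃ w, (G.walksFT m v w).Nonempty := by
  induction m, hm using Nat.le_induction with
  | base =>
    obtain ⟨e, rfl⟩ := h v
    exact ⟨_, _, G.singleton_mem_walksFT e⟩
  | succ m _ ih =>
    obtain ⟨w, p, hp⟩ := ih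
    obtain ⟨e, rfl⟩ := h w
    exact ⟨_, _, G.append_mem_walksFT hp (G.singleton_mem_walksFT e)⟩

end DirGraph

theorem payoffSum_append {EG EH : Type} (P : EG → EH → ℤ) {q q' : List EG} {p p' : List EH}
    (h : q.length = p.length) :
    payoffSum P (q ++ q') (p ++ p') = payoffSum P q p + payoffSum P q' p' := by
  simp [payoffSum, List.zipWith_append h]

section Mfun

variable {VG EG EH : Type} [Finite EG] (G : DirGraph VG EG) (P : EG → EH → ℤ)

theorem le_Mfun_iff (p : List EH) (v w : VG) (a : WithTop ℤ) :
    a ≤ Mfun G P p v w ↔ ∀ q ∈ G.walksFT p.length v w, a ≤ (payoffSum P q p : ℤ) := by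
  rw [Mfun, WithTop.le_sInf_iff_of_finite ((G.finite_walksFT _ v w).image _), forall_mem_image]

theorem exists_walk_of_Mfun_ne_top {p : List EH} {v w : VG} (h : Mfun G P p v w ≠ ⊤) :
    ∃ q ∈ G.walksFT p.length v w, ((payoffSum P q p : ℤ) : WithTop ℤ) = Mfun G P p v w := by
  by_contra! hq
  have hne : (G.walksFT p.length v w).Nonempty := by
    by_contra hempty
    rw [not_nonempty_iff_eq_empty] at hempty
    exact h (top_le_iff.1 ((le_Mfun_iff G P p v w ⊤).2 (by simp [hempty])))
  obtain ⟨q, hqm, hle⟩ := exists_min_image _ (fun q => payoffSum P q p)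
    (G.finite_walksFT p.length v w) hne
  refine hq q hqm (le_antisymm ?_ ((le_Mfun_iff G P p v w _).1 le_rfl q hqm))
  exact (le_Mfun_iff G P p v w _).2 fun q' hq' => WithTop.coe_le_coe.2 (hle q' hq')

theorem Mfun_ne_top_of_walk {p : List EH} {v w : VG} (h : (G.walksFT p.length v w).Nonempty) :
    Mfun G P p v w ≠ ⊤ := by
  obtain ⟨q, hq⟩ := h
  exact ne_top_of_le_ne_top WithTop.coe_ne_top ((le_Mfun_iff G P p v w _).1 le_rfl q hq)

end Mfun

section tconv

variable {V : Type} [Finite V]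

theorem le_tconv_iff (f g : V → V → WithTop ℤ) (x y : V) (a : WithTop ℤ) :
    a ≤ tconv f g x y ↔ ∀ v, a ≤ f x v + g v y := by
  rw [tconv, WithTop.le_sInf_iff_of_finite (finite_range _), forall_mem_range]

theorem tconv_lt_iff (f g : V → V → WithTop ℤ) (x y : V) (a : WithTop ℤ) :
    tconv f g x y < a ↔ ∃ v, f x v + g v y < a := by
  constructor
  · intro h
    by_contra! h'
    exact h.not_ge ((le_tconv_iff f g x y a).2 h')
  · rintro ⟨v, hv⟩
    exact ((le_tconv_iff f g x y _).1 le_rfl v).trans_lt hv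

theorem exists_tconv_eq [Nonempty V] (f g : V → V → WithTop ℤ) (x y : V) :
    ∃ v, tconv f g x y = f x v + g v y := by
  obtain ⟨v, hv⟩ := Finite.exists_min fun v => f x v + g v y
  exact ⟨v, le_antisymm ((le_tconv_iff f g x y _).1 le_rfl v) ((le_tconv_iff f g x y _).2 hv)⟩

theorem tconv_strictDom_left {f f' g : V → V → WithTop ℤ} (hf : StrictDom f f')
    (hg : ∀ y, ∃ v, g v y ≠ ⊤) : StrictDom (tconv f g) (tconv f' g) := by
  intro x y
  have : Nonempty V := ⟨x⟩
  obtain ⟨v, hv⟩ := exists_tconv_eq f' g x y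
  rw [hv, tconv_lt_iff]
  by_cases hgv : g v y = ⊤
  · obtain ⟨v', hv'⟩ := hg y
    exact ⟨v', by simpa [hgv, WithTop.add_lt_top, lt_top_iff_ne_top] using
      ⟨(hf x v').ne_top, hv'⟩⟩
  · exact ⟨v, WithTop.add_lt_add_right hgv (hf x v)⟩

theorem tconv_strictDom_right {f g g' : V → V → WithTop ℤ} (hg : StrictDom g g')
    (hf : ∀ x, ∃ v, f x v ≠ ⊤) : StrictDom (tconv f g) (tconv f g') := by
  intro x y
  have : Nonempty V := ⟨x⟩
  obtain ⟨v, hv⟩ := exists_tconv_eq f g' x y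
  rw [hv, tconv_lt_iff]
  by_cases hfv : f x v = ⊤
  · obtain ⟨v', hv'⟩ := hf x
    exact ⟨v', by simpa [hfv, WithTop.add_lt_top, lt_top_iff_ne_top] using
      ⟨hv', (hg v' y).ne_top⟩⟩
  · exact ⟨v, WithTop.add_lt_add_left hfv (hg v y)⟩

theorem Mfun_append {EG EH : Type} [Finite EG] (G : DirGraph V EG) (P : EG → EH → ℤ)
    {p q : List EH} (hp : p ≠ []) (hq : q ≠ []) :
    Mfun G P (p ++ q) = tconv (Mfun G P p) (Mfun G P q) := by
  ext1 x; ext1 y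
  apply le_antisymm
  · refine (le_tconv_iff _ _ x y _).2 fun v => ?_
    by_cases h1 : Mfun G P p x v = ⊤
    · simp [h1]
    by_cases h2 : Mfun G P q v y = ⊤
    · simp [h2]
    obtain ⟨r, hr, hr'⟩ := exists_walk_of_Mfun_ne_top G P h1
    obtain ⟨s, hs, hs'⟩ := exists_walk_of_Mfun_ne_top G P h2
    rw [← hr', ← hs', ← WithTop.coe_add, ← payoffSum_append P hr.1]
    refine (le_Mfun_iff G P _ x y _).1 le_rfl _ ?_
    rw [List.length_append]
    exact G.append_mem_walksFT hr hs
  · refine (le_Mfun_iff G P _ x y _).2 fun t ht => ?_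
    rw [List.length_append] at ht
    obtain ⟨v, r, hr, s, hs, rfl⟩ := G.exists_append_of_mem_walksFT
      (List.length_pos_iff.2 hp) (List.length_pos_iff.2 hq) ht
    rw [payoffSum_append P hr.1, WithTop.coe_add]
    exact ((le_tconv_iff _ _ x y _).1 le_rfl v).trans
      (add_le_add ((le_Mfun_iff G P _ _ _ _).1 le_rfl r hr)
        ((le_Mfun_iff G P _ _ _ _).1 le_rfl s hs))

end tconv

theorem image_Mfun_walksFT_add {VG EG VH EH : Type} [Finite VG] [Finite EG]
    (G : DirGraph VG EG) (H : DirGraph VH EH) (P : EG → EH → ℤ) {m n : ℕ} (hn : 0 < n)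
    (hm : 0 < m) (u w : VH) :
    Mfun G P '' H.walksFT (n + m) u w = ⋃ v : VH, Set.image2 tconv
      (Mfun G P '' H.walksFT n u v) (Mfun G P '' H.walksFT m v w) := by
  ext a
  simp only [mem_iUnion, mem_image2, mem_image]
  constructor
  · rintro ⟨r, hr, rfl⟩
    obtain ⟨v, p, hp, q, hq, rfl⟩ := H.exists_append_of_mem_walksFT hn hm hr
    exact ⟨v, _, ⟨p, hp, rfl⟩, _, ⟨q, hq, rfl⟩, (Mfun_append G P hp.2.2.1 hq.2.2.1).symm⟩
  · rintro ⟨v, _, ⟨p, hp, rfl⟩, _, ⟨q, hq, rfl⟩, rfl⟩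
    exact ⟨p ++ q, H.append_mem_walksFT hp hq, Mfun_append G P hp.2.2.1 hq.2.2.1⟩

theorem StrictDom.trans {V α : Type} [Preorder α] {f g h : V → V → α} (hfg : StrictDom f g)
    (hgh : StrictDom g h) : StrictDom f h :=
  fun v w => (hfg v w).trans (hgh v w)

theorem maxElems_eq_of_subset {V α : Type} [Preorder α] {A B : Set (V → V → α)} (hBA : B ⊆ A)
    (h : ∀ a ∈ A, a ∈ B ∨ ∃ b ∈ B, StrictDom a b) :
    maxElems StrictDom A = maxElems StrictDom B := by
  ext a
  constructor
  · rintro ⟨ha, hmax⟩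
    refine ⟨(h a ha).resolve_right ?_, ?_⟩
    all_goals exact fun ⟨b, hb, hab⟩ => hmax ⟨b, hBA hb, hab⟩
  · rintro ⟨ha, hmax⟩
    refine ⟨hBA ha, fun ⟨b, hb, hab⟩ => ?_⟩
    rcases h b hb with hb' | ⟨c, hc, hbc⟩
    · exact hmax ⟨b, hb', hab⟩
    · exact hmax ⟨c, hc, hab.trans hbc⟩

theorem mem_maxElems_or_exists_strictDom {V α : Type} [Nonempty V] [Preorder α]
    {A : Set (V → V → α)} (hA : A.Finite) {a : V → V → α} (ha : a ∈ A) :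
    a ∈ maxElems StrictDom A ∨ ∃ b ∈ maxElems StrictDom A, StrictDom a b := by
  obtain ⟨v⟩ := ‹Nonempty V›
  by_cases hmax : a ∈ maxElems StrictDom A
  · exact Or.inl hmax
  obtain ⟨b, hb, hab⟩ : ∃ b ∈ A, StrictDom a b := by
    by_contra h
    exact hmax ⟨ha, h⟩
  obtain ⟨c, ⟨hc, hac⟩, hcmax⟩ := (hA.subset (sep_subset A (StrictDom a))).exists_maximalFor
    (fun b => b v v) _ ⟨b, hb, hab⟩
  exact Or.inr ⟨c, ⟨hc, fun ⟨d, hd, hcd⟩ =>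
    (hcd v v).not_ge (hcmax ⟨hd, hac.trans hcd⟩ (hcd v v).le)⟩, hac⟩

/-- `M†_{n+m}(u→w) = (⋃_v M†_n(u→v) * M†_m(v→w))†`. -/
theorem Mdagger_recursion {VG EG VH EH : Type} [Fintype VG] [Fintype EG]
    [Fintype VH] [Fintype EH] (G : DirGraph VG EG) (H : DirGraph VH EH)
    (P : EG → EH → ℤ) (m n : ℕ) (hn : 0 < n) (hm : 0 < m) (u w : VH) :
    maxElems StrictDom (Mfun G P '' H.walksFT (n + m) u w)
      = maxElems StrictDom (⋃ v : VH, Set.image2 tconv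
          (maxElems StrictDom (Mfun G P '' H.walksFT n u v))
          (maxElems StrictDom (Mfun G P '' H.walksFT m v w))) := by
  rcases isEmpty_or_nonempty VG with hV | hV
  · have h (A : Set (VG → VG → WithTop ℤ)) : maxElems StrictDom A = ∅ :=
      eq_empty_of_forall_notMem fun f hf => hf.2 ⟨f, hf.1, fun v => hV.elim v⟩
    rw [h, h]
  have hfin (k : ℕ) (v v' : VH) : (Mfun G P '' H.walksFT k v v').Finite :=
    (H.finite_walksFT k v v').image _
  have hwalk {k : ℕ} {v v' : VH} {f g : VG → VG → WithTop ℤ}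
      (hf : f ∈ Mfun G P '' H.walksFT k v v') (hfg : StrictDom f g) (x y : VG) :
      ∃ q, q ∈ G.walksFT k x y := by
    obtain ⟨p, hp, rfl⟩ := hf
    obtain ⟨q, hq, -⟩ := exists_walk_of_Mfun_ne_top G P (hfg x y).ne_top
    exact ⟨q, hp.1 ▸ hq⟩
  have hleft {k l : ℕ} (hl : 0 < l) {v₁ v₂ v₃ v₄ : VH} {f f' g : VG → VG → WithTop ℤ}
      (hf : f ∈ Mfun G P '' H.walksFT k v₁ v₂) (hff : StrictDom f f')
      (hg : g ∈ Mfun G P '' H.walksFT l v₃ v₄) : StrictDom (tconv f g) (tconv f' g) := by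
    refine tconv_strictDom_left hff fun y => ?_
    obtain ⟨p, hp, rfl⟩ := hg
    obtain ⟨v, hv⟩ := G.exists_walksFT_to (fun z => by
      obtain ⟨q, -, -, _, -, hz⟩ := hwalk hf hff z z
      exact ⟨_, hz⟩) hl y
    exact ⟨v, Mfun_ne_top_of_walk G P (hp.1.symm ▸ hv)⟩
  have hright {k l : ℕ} (hl : 0 < l) {v₁ v₂ v₃ v₄ : VH} {f g g' : VG → VG → WithTop ℤ}
      (hg : g ∈ Mfun G P '' H.walksFT k v₁ v₂) (hgg : StrictDom g g')
      (hf : f ∈ Mfun G P '' H.walksFT l v₃ v₄) : StrictDom (tconv f g) (tconv f g') := by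
    refine tconv_strictDom_right hgg fun x => ?_
    obtain ⟨p, hp, rfl⟩ := hf
    obtain ⟨v, hv⟩ := G.exists_walksFT_from (fun z => by
      obtain ⟨q, -, -, _, hz, -⟩ := hwalk hg hgg z z
      exact ⟨_, hz⟩) hl x
    exact ⟨v, Mfun_ne_top_of_walk G P (hp.1.symm ▸ hv)⟩
  rw [image_Mfun_walksFT_add G H P hn hm]
  apply maxElems_eq_of_subset
  · exact iUnion_mono fun v => image2_subset (sep_subset _ _) (sep_subset _ _)
  · intro a ha
    obtain ⟨v, f, hf, g, hg, rfl⟩ := mem_iUnion.1 ha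
    have hmem {f' g' : VG → VG → WithTop ℤ}
        (hf' : f' ∈ maxElems StrictDom (Mfun G P '' H.walksFT n u v))
        (hg' : g' ∈ maxElems StrictDom (Mfun G P '' H.walksFT m v w)) :=
      mem_iUnion_of_mem (s := fun v => Set.image2 tconv
        (maxElems StrictDom (Mfun G P '' H.walksFT n u v))
        (maxElems StrictDom (Mfun G P '' H.walksFT m v w))) v (mem_image2_of_mem hf' hg')
    rcases mem_maxElems_or_exists_strictDom (hfin n u v) hf with hf' | ⟨f', hf', hff⟩ <;>
      rcases mem_maxElems_or_exists_strictDom (hfin m v w) hg with hg' | ⟨g', hg', hgg⟩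
    · exact Or.inl (hmem hf' hg')
    · exact Or.inr ⟨_, hmem hf' hg', hright hn hg hgg hf⟩
    · exact Or.inr ⟨_, hmem hf' hg', hleft hm hf hff hg⟩
    · exact Or.inr ⟨_, hmem hf' hg', (hleft hm hf hff hg).trans (hright hn hg hgg hf'.1)⟩
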